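/- arXiv:2501.14125 — 3 statements merged into one kernel-verified Lean document; each statement's English description precedes it below -/
import Mathlib

section
/- For n > 1 and fixed k ∈ [0, n-1], Ω_k^{(n)} = θ_{2k+1}^{(n+k+1)}. -/
open Finset

/-- `l` encodes a (non-degenerate) indexing matrix on `n` points: the columns,
listed left to right, as pairs `(top entry, bottom entry)`.  Entries lie in
`[0, n-1]`, the first row is strictly increasing, the second row is weakly
increasing, repeated second-row entries are `0`, and each top entry is at
least the corresponding bottom entry. -/
def IsIndexingMatrix (n : ℕ) (l : List (ℕ × ℕ)) : Prop :=
  1 ≤ l.length ∧ l.length ≤ n ∧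
  (∀ p ∈ l, p.1 < n ∧ p.2 ≤ p.1) ∧
  l.Pairwise (fun p q => p.1 < q.1 ∧ p.2 ≤ q.2 ∧ (p.2 = q.2 → p.2 = 0))

/-- A positive indexing matrix: all entries are positive. -/
def IsPositiveIndexingMatrix (n : ℕ) (l : List (ℕ × ℕ)) : Prop :=
  IsIndexingMatrix n l ∧ ∀ p ∈ l, 0 < p.1 ∧ 0 < p.2

/-- `θ_k^{(n)}`: the number of positive indexing matrices whose `(1,1)` entry
equals `k`. -/
noncomputable def theta (n k : ℕ) : ℕ :=
  Nat.card {l : List (ℕ × ℕ) //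
    IsPositiveIndexingMatrix n l ∧ l.head?.map Prod.fst = some k}

/-- The blob-rank of an indexing matrix: the number of its columns containing
a `0`. -/
def blobRank (l : List (ℕ × ℕ)) : ℕ := l.countP (fun p => p.1 == 0 || p.2 == 0)

/-- `Ω_r^{(n)}`: the number of indexing matrices on `n` points of blob-rank `r`,
the degenerate indexing matrix being counted in `Ω_0^{(n)}`. -/
noncomputable def Omega (n r : ℕ) : ℕ :=
  Nat.card {l : List (ℕ × ℕ) // IsIndexingMatrix n l ∧ blobRank l = r} +
    (if r = 0 then 1 else 0)

/-- `χ_k^{(n)} = Σ_{i₁+⋯+i_k = n-k} C_{i₁} ⋯ C_{i_k}` (Catalan numbers). -/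
def chi (n k : ℕ) : ℕ :=
  ∑ t ∈ Finset.Nat.antidiagonalTuple k (n - k), ∏ j, catalan (t j)

/-- A Temperley–Lieb diagram on `n` points: a non-crossing perfect matching of
`2n` boundary points numbered clockwise, given by a fixed-point free
involution. -/
structure TLDiagram (n : ℕ) where
  f : Fin (2 * n) → Fin (2 * n)
  involutive : ∀ x, f (f x) = x
  noFixedPoint : ∀ x, f x ≠ x
  noncrossing : ∀ a b : Fin (2 * n), a < b → b < f a → f a < f b → False

/-- `a` is the left (smaller) endpoint of an arc of `D`. -/
def TLDiagram.IsArc {n : ℕ} (D : TLDiagram n) (a : Fin (2 * n)) : Prop :=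
  a < D.f a

/-- The arc with left endpoint `a` is exposed to the left side of the diagram,
i.e. it is not nested inside any other arc. -/
def TLDiagram.IsExposed {n : ℕ} (D : TLDiagram n) (a : Fin (2 * n)) : Prop :=
  a < D.f a ∧ ∀ c, ¬ (c < a ∧ D.f a < D.f c)

/-- The number of arcs of `D` exposed to the left side. -/
noncomputable def exposedCount {n : ℕ} (D : TLDiagram n) : ℕ :=
  Nat.card {a : Fin (2 * n) // D.IsExposed a}

/-- A `d`-abacus blob diagram on `n` points: a TL-diagram together with blobs
on some arcs exposed to the left, one bead count in `ℤ/dℤ` on every arc, and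
an extra bead count on every blobbed arc (its second component). -/
structure AbacusBlobDiagram (d n : ℕ) where
  base : TLDiagram n
  blob : Fin (2 * n) → Bool
  blob_exposed : ∀ a, blob a = true → base.IsExposed a
  beads₁ : Fin (2 * n) → ZMod d
  beads₂ : Fin (2 * n) → ZMod d
  beads₁_arc : ∀ a, ¬ base.IsArc a → beads₁ a = 0
  beads₂_blob : ∀ a, blob a = false → beads₂ a = 0

/-- A `d`-abacus hook diagram on `n` points: a blobbed TL-diagram in which all
blobbed arcs are merged into the single hook component through `0, 0'`, with a
bead count in `ℤ/dℤ` on every unblobbed arc and one on the hook component. -/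
structure AbacusHookDiagram (d n : ℕ) where
  base : TLDiagram n
  blob : Fin (2 * n) → Bool
  blob_exposed : ∀ a, blob a = true → base.IsExposed a
  beads : Fin (2 * n) → ZMod d
  beads_arc : ∀ a, ¬ base.IsArc a ∨ blob a = true → beads a = 0
  hookBeads : ZMod d

namespace Stmt10

def T (g : ℕ → ℕ) : ℕ → ℕ := fun s => g s + g (s + 1)
def D (g : ℕ → ℕ) : ℕ → ℕ := fun s => match s with
  | 0 => 0
  | s + 1 => g s
def E (g : ℕ → ℕ) : ℕ → ℕ := fun s => g s + D g s
def delta : ℕ → ℕ := fun s => if s = 0 then 1 else 0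

/-- pairs of strictly increasing lists with the interlacing condition -/
def S (n p q h : ℕ) : Set (List ℕ × List ℕ) :=
  {x | x.1.Pairwise (· < ·) ∧ x.2.Pairwise (· < ·) ∧ (∀ a ∈ x.1, p ≤ a ∧ a < n) ∧
    (∀ b ∈ x.2, q ≤ b ∧ b < n) ∧ x.1.length = x.2.length + h ∧
    List.Forall₂ (· ≤ ·) x.2 (x.1.drop h)}

lemma sorted_finite (n : ℕ) : {l : List ℕ | l.Pairwise (· < ·) ∧ ∀ a ∈ l, a < n}.Finite := by
  refine ((List.range n).sublists.finite_toSet).subset ?_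
  intro l hl
  simp only [Set.mem_setOf_eq, List.mem_sublists] at hl ⊢
  refine List.sublist_of_subperm_of_pairwise (r := (· < ·)) ?_ hl.1 List.pairwise_lt_range
  apply List.subperm_of_subset
  · exact hl.1.imp (fun h => ne_of_lt h)
  · intro a ha; simpa using hl.2 a ha

lemma S_finite (n p q h : ℕ) : (S n p q h).Finite := by
  refine ((sorted_finite n).prod (sorted_finite n)).subset ?_
  rintro ⟨A, B⟩ ⟨h1, h2, h3, h4, -, -⟩
  exact ⟨⟨h1, fun a ha => (h3 a ha).2⟩, ⟨h2, fun a ha => (h4 a ha).2⟩⟩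

lemma S_stepB (n p q : ℕ) (hq : q ≤ p) (hn : q < n) (h : ℕ) :
    (S n p q h).ncard = (S n p (q + 1) h).ncard + (S n p (q + 1) (h + 1)).ncard := by
  have key : S n p q h = S n p (q + 1) h ∪ (fun x => (x.1, q :: x.2)) '' S n p (q + 1) (h + 1) := by
    ext ⟨A, B⟩
    constructor
    · rintro ⟨h1, h2, h3, h4, h5, h6⟩
      simp only at h1 h2 h3 h4 h5 h6
      by_cases hB : q ∈ B
      · right
        cases B with
        | nil => simp at hB
        | cons b B =>
          have hb : b = q := by
            rcases List.mem_cons.1 hB with e | e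
            · exact e.symm
            · have := (List.pairwise_cons.1 h2).1 q e
              have := (h4 b (by simp)).1
              omega
          subst hb
          refine ⟨(A, B), ⟨h1, (List.pairwise_cons.1 h2).2, h3, ?_, ?_, ?_⟩, rfl⟩
          · intro x hx
            exact ⟨(List.pairwise_cons.1 h2).1 x hx, (h4 x (by simp [hx])).2⟩
          · simp at h5 ⊢; omega
          · simp only
            rw [← List.tail_drop]
            cases hd : A.drop h with
            | nil => rw [hd] at h6; cases h6
            | cons a A' => rw [hd] at h6; cases h6; simpa
      · left
        refine ⟨h1, h2, h3, ?_, h5, h6⟩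
        intro b hb
        have := h4 b hb
        have : b ≠ q := fun e => hB (e ▸ hb)
        simp only at *
        omega
    · rintro (⟨h1, h2, h3, h4, h5, h6⟩ | ⟨⟨A', B'⟩, ⟨h1, h2, h3, h4, h5, h6⟩, e⟩)
      · exact ⟨h1, h2, h3, fun b hb => ⟨by have := (h4 b hb).1; omega, (h4 b hb).2⟩, h5, h6⟩
      · simp only [Prod.mk.injEq] at e
        obtain ⟨rfl, rfl⟩ := e
        simp only at h1 h2 h3 h4 h5 h6
        refine ⟨h1, List.pairwise_cons.2 ⟨fun b hb => (h4 b hb).1, h2⟩, h3, ?_, ?_, ?_⟩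
        · intro b hb
          rcases List.mem_cons.1 hb with e | e
          · subst e; exact ⟨le_rfl, hn⟩
          · have := h4 b e; omega
        · simp; omega
        · simp only
          have hl : h < A'.length := by omega
          rw [List.drop_eq_getElem_cons hl]
          refine List.Forall₂.cons ?_ h6
          exact hq.trans (h3 _ (List.getElem_mem hl)).1
  rw [key, Set.ncard_union_eq _ (S_finite _ _ _ _) ((S_finite _ _ _ _).image _),
    Set.ncard_image_of_injective]
  · rintro ⟨A, B⟩ ⟨A', B'⟩ e
    simpa using e
  · rw [Set.disjoint_left]
    rintro x hx ⟨y, hy, rfl⟩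
    have := (hx.2.2.2.1 q (by simp)).1
    omega

lemma S_stepA0 (n p q : ℕ) (hq : p < q) :
    (S n p q 0) = (S n (p + 1) q 0) := by
  ext ⟨A, B⟩
  constructor
  · rintro ⟨h1, h2, h3, h4, h5, h6⟩
    simp only at h1 h2 h3 h4 h5 h6
    refine ⟨h1, h2, ?_, h4, h5, h6⟩
    simp only [List.drop_zero] at h6 ⊢
    intro a ha
    refine ⟨?_, (h3 a ha).2⟩
    cases h6 with
    | nil => simp at ha
    | @cons b a' B' A' hab _ =>
      have := (h4 b (by simp)).1
      rcases List.mem_cons.1 ha with e | e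
      · omega
      · have := (List.pairwise_cons.1 h1).1 a e
        omega
  · rintro ⟨h1, h2, h3, h4, h5, h6⟩
    exact ⟨h1, h2, fun b hb => ⟨by have := (h3 b hb).1; omega, (h3 b hb).2⟩, h4, h5, h6⟩

lemma S_stepA (n p q : ℕ) (hn : p < n) (h : ℕ) :
    (S n p q (h+1)).ncard = (S n (p + 1) q (h+1)).ncard + (S n (p+1) q h).ncard := by
  have key : S n p q (h+1) =
      S n (p+1) q (h+1) ∪ (fun x => (p :: x.1, x.2)) '' S n (p+1) q h := by
    ext ⟨A, B⟩
    constructor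
    · rintro ⟨h1, h2, h3, h4, h5, h6⟩
      simp only at h1 h2 h3 h4 h5 h6
      by_cases hA : p ∈ A
      · right
        cases A with
        | nil => simp at hA
        | cons b A =>
          have hb : b = p := by
            rcases List.mem_cons.1 hA with e | e
            · exact e.symm
            · have := (List.pairwise_cons.1 h1).1 p e
              have := (h3 b (by simp)).1
              omega
          subst hb
          refine ⟨(A, B), ⟨(List.pairwise_cons.1 h1).2, h2, ?_, h4, ?_, ?_⟩, rfl⟩
          · intro x hx
            exact ⟨(List.pairwise_cons.1 h1).1 x hx, (h3 x (by simp [hx])).2⟩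
          · simp at h5 ⊢; omega
          · simpa using h6
      · left
        refine ⟨h1, h2, ?_, h4, h5, h6⟩
        intro b hb
        have := h3 b hb
        have : b ≠ p := fun e => hA (e ▸ hb)
        simp only at *
        omega
    · rintro (⟨h1, h2, h3, h4, h5, h6⟩ | ⟨⟨A', B'⟩, ⟨h1, h2, h3, h4, h5, h6⟩, e⟩)
      · exact ⟨h1, h2, fun b hb => ⟨by have := (h3 b hb).1; omega, (h3 b hb).2⟩, h4, h5, h6⟩
      · simp only [Prod.mk.injEq] at e
        obtain ⟨rfl, rfl⟩ := e
        simp only at h1 h2 h3 h4 h5 h6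
        refine ⟨List.pairwise_cons.2 ⟨fun b hb => (h3 b hb).1, h1⟩, h2, ?_, h4, ?_, ?_⟩
        · intro b hb
          rcases List.mem_cons.1 hb with e | e
          · subst e; exact ⟨le_rfl, hn⟩
          · have := h3 b e; omega
        · simp; omega
        · simpa using h6
  rw [key, Set.ncard_union_eq _ (S_finite _ _ _ _) ((S_finite _ _ _ _).image _),
    Set.ncard_image_of_injective]
  · rintro ⟨A, B⟩ ⟨A', B'⟩ e
    simpa using e
  · rw [Set.disjoint_left]
    rintro x hx ⟨y, hy, rfl⟩
    have := (hx.2.2.1 p (by simp)).1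
    omega

noncomputable def N (n p q : ℕ) : ℕ → ℕ := fun h => (S n p q h).ncard

lemma N_B (n p q : ℕ) (hq : q ≤ p) (hn : q < n) : N n p q = T (N n p (q+1)) := by
  funext h; exact S_stepB n p q hq hn h

lemma N_A (n p q : ℕ) (hq : p < q) (hn : p < n) : N n p q = E (N n (p+1) q) := by
  funext h
  cases h with
  | zero => simp [N, E, D, S_stepA0 n p q hq]
  | succ h => exact S_stepA n p q hn h

lemma N_end (n : ℕ) : N n n n = delta := by
  funext h
  have : S n n n h = if h = 0 then {([], [])} else ∅ := by
    ext ⟨A, B⟩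
    have e : ∀ l : List ℕ, (∀ a ∈ l, n ≤ a ∧ a < n) → l = [] := by
      intro l hl
      cases l with
      | nil => rfl
      | cons a l => have := hl a (by simp); omega
    constructor
    · rintro ⟨h1, h2, h3, h4, h5, h6⟩
      have hA := e _ h3
      have hB := e _ h4
      simp only at hA hB
      subst hA hB
      simp at h5
      simp [← h5]
    · split_ifs with h0
      · intro h; simp at h; obtain ⟨rfl, rfl⟩ := h; subst h0; simp [S]
      · simp
  simp only [N, this, delta]
  split_ifs <;> simp

lemma N_diag (d p : ℕ) : N (p + d) p p = (fun g => T (E g))^[d] delta := by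
  induction d generalizing p with
  | zero => exact N_end p
  | succ d ih =>
    rw [N_B _ _ _ le_rfl (by omega), N_A _ _ _ (by omega) (by omega), Function.iterate_succ_apply',
      ← ih (p+1)]
    congr 3; omega

lemma N_Bs (j n p q : ℕ) (hq : q + j ≤ p + 1) (hn : q + j ≤ n) : N n p q = T^[j] (N n p (q+j)) := by
  induction j generalizing q with
  | zero => rfl
  | succ j ih =>
    rw [N_B _ _ _ (by omega) (by omega), Function.iterate_succ_apply', ih (q+1) (by omega) (by omega)]
    congr 3; omega

lemma T_D (g : ℕ → ℕ) : T (D g) = E g := by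
  funext s; simp only [T, E, D]; cases s <;> simp <;> omega

lemma T_add (f g : ℕ → ℕ) : T (fun s => f s + g s) = fun s => T f s + T g s := by
  funext s; simp only [T]; omega

lemma Ti_add (j : ℕ) (f g : ℕ → ℕ) :
    T^[j] (fun s => f s + g s) = fun s => T^[j] f s + T^[j] g s := by
  induction j generalizing f g with
  | zero => rfl
  | succ j ih => rw [Function.iterate_succ_apply, T_add, ih]; rfl

/-- The heart: `U E = T`. -/
lemma ET (j : ℕ) (F : ℕ → ℕ) (r : ℕ) :
    (fun g => E (T g))^[j] F (j + r) = T^[2 * j] F r := by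
  induction j generalizing r with
  | zero => simp
  | succ j ih =>
    rw [Function.iterate_succ_apply', show 2 * (j+1) = (2*j+1)+1 by ring,
      Function.iterate_succ_apply', Function.iterate_succ_apply']
    have e1 : j + 1 + r = (j + r) + 1 := by omega
    rw [e1]
    simp only [E, D, T]
    have := ih r
    have h1 := ih (r+1)
    have h2 := ih (r+2)
    simp only [← add_assoc] at h1 h2
    rw [show r + 2 = r + 1 + 1 from rfl] at h2
    rw [h1, h2, this]; omega

lemma E_TE (j : ℕ) (g : ℕ → ℕ) :
    E ((fun g => T (E g))^[j] g) = (fun g => E (T g))^[j] (E g) := by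
  induction j generalizing g with
  | zero => rfl
  | succ j ih => rw [Function.iterate_succ_apply, ih, Function.iterate_succ_apply]

abbrev R : ℕ × ℕ → ℕ × ℕ → Prop := fun p q => p.1 < q.1 ∧ p.2 ≤ q.2 ∧ (p.2 = q.2 → p.2 = 0)

def V (n lo k : ℕ) : Set (List (ℕ × ℕ)) :=
  {l | (∀ p ∈ l, lo ≤ p.1 ∧ p.1 < n ∧ p.2 ≤ p.1) ∧ l.Pairwise R ∧ blobRank l = k}

lemma struct_lemma (l : List (ℕ × ℕ)) (k : ℕ) (h1 : ∀ p ∈ l, p.2 ≤ p.1) (h2 : l.Pairwise R)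
    (h3 : blobRank l = k) :
    List.replicate k 0 ++ (l.map Prod.snd).drop k = l.map Prod.snd ∧
    ((l.map Prod.snd).drop k).Pairwise (· < ·) ∧ (∀ b ∈ (l.map Prod.snd).drop k, 1 ≤ b) ∧
    List.Forall₂ (· ≤ ·) ((l.map Prod.snd).drop k) ((l.map Prod.fst).drop k) := by
  induction l generalizing k with
  | nil => simp [blobRank] at h3; subst h3; simp
  | cons p l ih =>
    obtain ⟨a, b⟩ := p
    have ih' := ih (blobRank l) (fun p hp => h1 p (by simp [hp])) (List.pairwise_cons.1 h2).2 rfl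
    have hR := (List.pairwise_cons.1 h2).1
    have hab := h1 (a, b) (by simp)
    simp only at hab
    by_cases hb : b = 0
    · subst hb
      have : k = blobRank l + 1 := by rw [← h3]; simp [blobRank]
      subst this
      simpa [List.replicate_succ] using ih'
    · have h0 : blobRank l = 0 := by
        unfold blobRank
        rw [List.countP_eq_zero]
        intro q hq
        have := hR q hq
        have := h1 q (by simp [hq])
        simp only [R] at *
        simp; omega
      have : k = 0 := by
        rw [← h3]; unfold blobRank at h0 ⊢; rw [List.countP_cons, h0]; simp; omega
      subst this
      rw [h0] at ih'
      simp only [List.drop_zero, List.map_cons, List.pairwise_cons, List.mem_cons,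
        List.forall₂_cons, List.replicate_zero, List.nil_append, true_and] at ih' ⊢
      refine ⟨⟨?_, ih'.1⟩, ?_, hab, ih'.2.2⟩
      · intro x hx
        obtain ⟨q, hq, rfl⟩ := List.mem_map.1 hx
        have := hR q hq
        simp only [R] at *
        omega
      · rintro x (rfl | hx)
        · omega
        · exact ih'.2.1 x hx

lemma back_lemma (n lo k : ℕ) (A B : List ℕ) (h : (A, B) ∈ S n lo 1 k) :
    A.zip (List.replicate k 0 ++ B) ∈ V n lo k := by
  obtain ⟨h1, h2, h3, h4, h5, h6⟩ := h
  simp only at h1 h2 h3 h4 h5 h6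
  induction A generalizing k B with
  | nil =>
    have hk : k = 0 := by simp at h5; omega
    subst hk
    simp [V, blobRank]
  | cons a A ih =>
    have h1' := List.pairwise_cons.1 h1
    have ha := h3 a (by simp)
    cases k with
    | succ k =>
      obtain ⟨i1, i2, i3⟩ := ih k B h1'.2 h2 (fun x hx => h3 x (by simp [hx])) h4
        (by simp at h5; omega) (by simpa using h6)
      simp only [List.replicate_succ, List.cons_append, List.zip_cons_cons]
      refine ⟨?_, List.pairwise_cons.2 ⟨?_, i2⟩, ?_⟩
      · intro p hp
        rcases List.mem_cons.1 hp with rfl | hp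
        · exact ⟨ha.1, ha.2, by simp⟩
        · exact i1 p hp
      · rintro ⟨x, y⟩ hp
        have := h1'.1 x (List.of_mem_zip hp).1
        simp [R, this]
      · unfold blobRank at i3 ⊢; rw [List.countP_cons, i3]; simp
    | zero =>
      cases B with
      | nil => simp at h5
      | cons b B =>
        have h2' := List.pairwise_cons.1 h2
        simp only [List.drop_zero, List.forall₂_cons] at h6
        obtain ⟨i1, i2, i3⟩ := ih 0 B h1'.2 h2'.2 (fun x hx => h3 x (by simp [hx]))
          (fun x hx => h4 x (by simp [hx]))
          (by simp at h5; omega) (by simpa using h6.2)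
        have hb := h4 b (by simp)
        simp only [List.replicate_zero, List.nil_append, List.zip_cons_cons] at i1 i2 i3 ⊢
        refine ⟨?_, List.pairwise_cons.2 ⟨?_, i2⟩, ?_⟩
        · intro p hp
          rcases List.mem_cons.1 hp with rfl | hp
          · exact ⟨ha.1, ha.2, h6.1⟩
          · exact i1 p hp
        · rintro ⟨x, y⟩ hp
          have := h1'.1 x (List.of_mem_zip hp).1
          have := h2'.1 y (List.of_mem_zip hp).2
          simp only [R]
          omega
        · unfold blobRank at i3 ⊢
          rw [List.countP_cons, i3]; simp; omega

lemma V_eq (n lo k : ℕ) :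
    V n lo k = (fun x : List ℕ × List ℕ => x.1.zip (List.replicate k 0 ++ x.2)) '' S n lo 1 k := by
  ext l
  constructor
  · rintro ⟨h1, h2, h3⟩
    obtain ⟨s1, s2, s3, s4⟩ := struct_lemma l k (fun p hp => (h1 p hp).2.2) h2 h3
    refine ⟨(l.map Prod.fst, (l.map Prod.snd).drop k), ⟨?_, s2, ?_, ?_, ?_, s4⟩, ?_⟩
    · simp only [List.pairwise_map]
      exact h2.imp (fun h => h.1)
    · intro a ha
      obtain ⟨q, hq, rfl⟩ := List.mem_map.1 ha
      exact ⟨(h1 q hq).1, (h1 q hq).2.1⟩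
    · intro b hb
      refine ⟨s3 b hb, ?_⟩
      obtain ⟨q, hq, rfl⟩ := List.mem_map.1 (List.mem_of_mem_drop hb)
      have := h1 q hq
      omega
    · have : k ≤ l.length := by rw [← h3]; exact List.countP_le_length
      simp; omega
    · simp only [s1]
      exact (List.zip_of_prod rfl rfl).symm
  · rintro ⟨⟨A, B⟩, h, rfl⟩
    exact back_lemma n lo k A B h

lemma V_finite (n lo k : ℕ) : (V n lo k).Finite := by
  rw [V_eq]; exact (S_finite _ _ _ _).image _

lemma V_card (n lo k : ℕ) : (V n lo k).ncard = N n lo 1 k := by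
  rw [V_eq, Set.ncard_image_of_injOn]; rfl
  rintro ⟨A, B⟩ h ⟨A', B'⟩ h' e
  have l1 := h.2.2.2.2.1
  have l2 := h'.2.2.2.2.1
  simp only at e l1 l2
  have e1 := congrArg (List.map Prod.fst) e
  have e2 := congrArg (List.map Prod.snd) e
  rw [List.map_fst_zip (by simp; omega), List.map_fst_zip (by simp; omega)] at e1
  rw [List.map_snd_zip (by simp; omega), List.map_snd_zip (by simp; omega)] at e2
  rw [e1, List.append_cancel_left e2]

lemma len_le (n : ℕ) (l : List (ℕ × ℕ)) (h1 : ∀ p ∈ l, p.1 < n) (h2 : l.Pairwise R) :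
    l.length ≤ n := by
  have hnd : (l.map Prod.fst).Nodup := by
    rw [List.Nodup, List.pairwise_map]
    exact h2.imp (fun h => ne_of_lt h.1)
  have : (l.map Prod.fst) ⊆ List.range n := by
    intro a ha
    obtain ⟨q, hq, rfl⟩ := List.mem_map.1 ha
    simpa using h1 q hq
  simpa using (List.subperm_of_subset hnd this).length_le

lemma omega_eq (n k : ℕ) : Omega n k = N n 0 1 k := by
  rw [← V_card]
  have key : V n 0 k = {l | IsIndexingMatrix n l ∧ blobRank l = k} ∪ (if k = 0 then {[]} else ∅) := by
    ext l
    constructor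
    · rintro ⟨h1, h2, h3⟩
      cases l with
      | nil => right; simp [blobRank] at h3; simp [← h3]
      | cons p l =>
        left
        exact ⟨⟨by simp, len_le n _ (fun p hp => (h1 p hp).2.1) h2,
          fun p hp => (h1 p hp).2, h2⟩, h3⟩
    · rintro (⟨⟨_, _, h1, h2⟩, h3⟩ | h)
      · exact ⟨fun p hp => ⟨by omega, h1 p hp⟩, h2, h3⟩
      · split_ifs at h with h0
        · simp at h; subst h; simp [V, blobRank, h0]
        · simp at h
  have hf := V_finite n 0 k
  rw [key] at hf ⊢
  rw [Set.ncard_union_eq _ (hf.subset Set.subset_union_left) (hf.subset Set.subset_union_right)]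
  · unfold Omega
    congr 1
    split_ifs <;> simp
  · rw [Set.disjoint_left]
    rintro l ⟨⟨h, _⟩, _⟩ h'
    split_ifs at h'
    · simp at h'; subst h'; simp at h
    · simp at h'

lemma theta_eq (m j : ℕ) (hj : 0 < j) : theta m j + N m (j+1) 1 0 = N m j 1 0 := by
  rw [← V_card, ← V_card]
  have bz : ∀ l : List (ℕ × ℕ), blobRank l = 0 ↔ ∀ p ∈ l, 0 < p.1 ∧ 0 < p.2 := by
    intro l
    unfold blobRank
    rw [List.countP_eq_zero]
    simp [Nat.pos_iff_ne_zero]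
  have key : V m j 0 = {l | IsPositiveIndexingMatrix m l ∧ l.head?.map Prod.fst = some j} ∪
      V m (j+1) 0 := by
    ext l
    constructor
    · rintro ⟨h1, h2, h3⟩
      cases l with
      | nil => right; simp [V, blobRank]
      | cons p l =>
        by_cases hp : p.1 = j
        · left
          exact ⟨⟨⟨by simp, len_le m _ (fun p hp => (h1 p hp).2.1) h2,
            fun p hp => (h1 p hp).2, h2⟩, (bz _).1 h3⟩, by simp [hp]⟩
        · right
          refine ⟨fun q hq => ⟨?_, (h1 q hq).2⟩, h2, h3⟩
          have := (h1 p (by simp)).1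
          rcases List.mem_cons.1 hq with rfl | hq
          · omega
          · have := ((List.pairwise_cons.1 h2).1 q hq).1
            omega
    · rintro (⟨⟨⟨_, _, h1, h2⟩, h3⟩, h4⟩ | ⟨h1, h2, h3⟩)
      · refine ⟨fun p hp => ⟨?_, h1 p hp⟩, h2, (bz _).2 h3⟩
        cases l with
        | nil => simp at h4
        | cons q l =>
          simp at h4
          rcases List.mem_cons.1 hp with rfl | hp
          · omega
          · have := ((List.pairwise_cons.1 h2).1 p hp).1
            omega
      · exact ⟨fun p hp => ⟨by have := (h1 p hp).1; omega, (h1 p hp).2⟩, h2, h3⟩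
  have hf := V_finite m j 0
  rw [key] at hf ⊢
  rw [Set.ncard_union_eq _ (hf.subset Set.subset_union_left) (V_finite _ _ _)]
  · rfl
  · rw [Set.disjoint_left]
    rintro l ⟨_, h4⟩ ⟨h1, _⟩
    cases l with
    | nil => simp at h4
    | cons q l =>
      simp at h4
      have := (h1 q (by simp)).1
      omega

end Stmt10

open Stmt10

/-- for `n > 1` and `k ∈ [0, n-1]`,
`Ω_k^{(n)} = θ_{2k+1}^{(n+k+1)}`. -/
theorem stmt10 (n k : ℕ) (hn : 1 < n) (hk : k ≤ n - 1) :
    Omega n k = theta (n + k + 1) (2 * k + 1) := by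
  obtain ⟨d, rfl⟩ : ∃ d, n = 1 + (d + k) := ⟨n - 1 - k, by omega⟩
  have h1 : Omega (1 + (d + k)) k = T^[2 * k] (E ((fun g => T (E g))^[d] delta)) 0 := by
    rw [omega_eq, N_A _ _ _ (by omega) (by omega), zero_add, N_diag, add_comm d k,
      Function.iterate_add_apply, E_TE]
    exact ET k _ 0
  have h2 := theta_eq (1 + (d + k) + k + 1) (2 * k + 1) (by omega)
  have hm : 1 + (d + k) + k + 1 = (2 * k + 2) + d := by ring
  rw [hm] at h2 ⊢
  rw [N_Bs (2 * k + 1) _ (2 * k + 1 + 1) 1 (by omega) (by omega),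
    N_Bs (2 * k + 1) _ (2 * k + 1) 1 (by omega) (by omega),
    N_A _ (2 * k + 1) _ (by omega) (by omega)] at h2
  have e : 1 + (2 * k + 1) = 2 * k + 2 := by ring
  rw [e, show 2 * k + 1 + 1 = 2 * k + 2 by ring, N_diag] at h2
  rw [h1]
  generalize (fun g => T (E g))^[d] delta = g at h2 ⊢
  have h3 : T^[2 * k + 1] (E g) 0 = T^[2 * k + 1] g 0 + T^[2 * k] (E g) 0 := by
    have := congrFun (Ti_add (2 * k + 1) g (D g)) 0
    rw [Function.iterate_succ_apply T (2 * k) (D g), T_D] at this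
    exact this
  omega
end

section
/- For all d, n ≥ 1: Σ_{k=0}^{n} Ω_k^{(n)} d^k = Σ_{k=1}^{n} χ_k^{(n)} (1+d)^k. -/
open Finset

/-- Lists of columns with tops in `[t, t+j)` and bottoms at least `b`. -/
def colLists : ℕ → ℕ → ℕ → Finset (List (ℕ × ℕ))
  | 0, _, _ => {[]}
  | j + 1, t, b => colLists j (t + 1) b ∪
      (Finset.Ico b (t + 1)).biUnion (fun c =>
        (colLists j (t + 1) (if c = 0 then 0 else c + 1)).image (fun l => (t, c) :: l))

def ColProp (j t b : ℕ) (l : List (ℕ × ℕ)) : Prop :=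
  (∀ p ∈ l, t ≤ p.1 ∧ p.1 < t + j ∧ b ≤ p.2 ∧ p.2 ≤ p.1) ∧
  l.Pairwise (fun p q => p.1 < q.1 ∧ p.2 ≤ q.2 ∧ (p.2 = q.2 → p.2 = 0))

theorem mem_colLists (j : ℕ) : ∀ (t b : ℕ) (l : List (ℕ × ℕ)),
    l ∈ colLists j t b ↔ ColProp j t b l := by
  induction j with
  | zero =>
    intro t b l
    simp only [colLists, Finset.mem_singleton, ColProp]
    constructor
    · rintro rfl; simp
    · rintro ⟨h, -⟩
      cases l with
      | nil => rfl
      | cons p l =>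
        have := h p (by simp)
        omega
  | succ j ih =>
    intro t b l
    simp only [colLists, Finset.mem_union, Finset.mem_biUnion, Finset.mem_image, ih,
      Finset.mem_Ico]
    constructor
    · rintro (⟨h, hp⟩ | ⟨c, hc, l', ⟨h, hp⟩, rfl⟩)
      · refine ⟨fun p hm => ?_, hp⟩
        have := h p hm
        omega
      · refine ⟨fun p hm => ?_, ?_⟩
        · rcases List.mem_cons.1 hm with rfl | hm
          · simp only; omega
          · have := h p hm
            split_ifs at this <;> omega
        · refine List.pairwise_cons.2 ⟨fun q hq => ?_, hp⟩
          have := h q hq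
          simp only
          split_ifs at this <;> omega
    · rintro ⟨h, hp⟩
      cases l with
      | nil => left; exact ⟨by simp, by simp⟩
      | cons p l =>
        obtain ⟨hp1, hp2⟩ := List.pairwise_cons.1 hp
        have h0 := h p (by simp)
        by_cases ht : p.1 = t
        · right
          refine ⟨p.2, by omega, l, ⟨fun q hq => ?_, hp2⟩, ?_⟩
          · have h1 := h q (by simp [hq])
            have h2 := hp1 q hq
            split_ifs <;> omega
          · rw [← ht]
        · left
          refine ⟨fun q hq => ?_, hp⟩
          have h1 := h q hq
          rcases List.mem_cons.1 hq with rfl | hq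
          · omega
          · have h2 := hp1 q hq
            omega

theorem length_colLists (j : ℕ) : ∀ (t b : ℕ) (l : List (ℕ × ℕ)),
    l ∈ colLists j t b → l.length ≤ j := by
  induction j with
  | zero => intro t b l h; simp [colLists] at h; simp [h]
  | succ j ih =>
    intro t b l h
    simp only [colLists, Finset.mem_union, Finset.mem_biUnion, Finset.mem_image] at h
    rcases h with h | ⟨c, hc, l', h, rfl⟩
    · have := ih _ _ _ h
      omega
    · have := ih _ _ _ h
      simpa using this

def colSum (d j t b : ℕ) : ℕ := ∑ l ∈ colLists j t b, d ^ blobRank l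

theorem colSum_succ (d j t b : ℕ) : colSum d (j + 1) t b = colSum d j (t + 1) b +
    ∑ c ∈ Finset.Ico b (t + 1), (if c = 0 then d else 1) *
      colSum d j (t + 1) (if c = 0 then 0 else c + 1) := by
  unfold colSum
  rw [colLists, Finset.sum_union, Finset.sum_biUnion]
  · congr 1
    refine Finset.sum_congr rfl fun c hc => ?_
    rw [Finset.sum_image (by intro a _ b _ h; simpa using h), Finset.mul_sum]
    refine Finset.sum_congr rfl fun l hl => ?_
    have hc' := Finset.mem_Ico.1 hc
    by_cases h0 : c = 0
    · subst h0
      simp [blobRank, pow_succ, mul_comm]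
    · have : t ≠ 0 := by omega
      simp [blobRank, h0, this]
  · intro a _ b _ hab
    rw [Function.onFun, Finset.disjoint_left]
    intro l h1 h2
    simp only [Finset.mem_image] at h1 h2
    obtain ⟨x, -, rfl⟩ := h1
    obtain ⟨y, -, hy⟩ := h2
    simp at hy
    exact hab hy.1.symm
  · rw [Finset.disjoint_left]
    intro l h1 h2
    simp only [Finset.mem_biUnion, Finset.mem_image] at h2
    obtain ⟨c, -, x, -, rfl⟩ := h2
    have := ((mem_colLists _ _ _ _).1 h1).1 (t, c) (by simp)
    simp at this

/-- `[x^j] C(x)^k`. -/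
noncomputable def catPow (j k : ℕ) : ℕ :=
  PowerSeries.coeff j ((PowerSeries.mk catalan : PowerSeries ℕ) ^ k)

theorem catSeries_eq : (PowerSeries.mk catalan : PowerSeries ℕ) =
    1 + PowerSeries.X * (PowerSeries.mk catalan) ^ 2 := by
  ext n
  cases n with
  | zero => simp
  | succ n =>
    rw [PowerSeries.coeff_mk, catalan_succ', map_add, PowerSeries.coeff_succ_X_mul, pow_two,
      PowerSeries.coeff_mul]
    simp [PowerSeries.coeff_one]

theorem catPow_zero_left (k : ℕ) : catPow 0 k = 1 := by
  simp [catPow]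

theorem catPow_zero_right (j : ℕ) : catPow (j + 1) 0 = 0 := by
  simp [catPow, PowerSeries.coeff_one]

theorem catPow_succ (j k : ℕ) : catPow (j + 1) (k + 1) = catPow (j + 1) k + catPow j (k + 2) := by
  unfold catPow
  have : (PowerSeries.mk catalan : PowerSeries ℕ) ^ (k + 1) =
      (PowerSeries.mk catalan) ^ k + PowerSeries.X * (PowerSeries.mk catalan) ^ (k + 2) := by
    have h := catSeries_eq
    generalize (PowerSeries.mk catalan : PowerSeries ℕ) = P at h ⊢
    calc P ^ (k + 1) = P ^ k * P := pow_succ _ _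
      _ = P ^ k * (1 + PowerSeries.X * P ^ 2) := by rw [← h]
      _ = _ := by ring
  rw [this, map_add, PowerSeries.coeff_succ_X_mul]

theorem catPow_sum (j k : ℕ) : catPow (j + 1) k = ∑ i ∈ Finset.range k, catPow j (i + 2) := by
  induction k with
  | zero => simp [catPow_zero_right]
  | succ k ih => rw [catPow_succ, ih, Finset.sum_range_succ]

theorem chiSum_eq (k : ℕ) : ∀ j : ℕ,
    ∑ t ∈ Finset.Nat.antidiagonalTuple k j, ∏ i, catalan (t i) = catPow j k := by
  induction k with
  | zero =>
    intro j
    cases j with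
    | zero => simp [catPow]
    | succ j => simp [catPow_zero_right]
  | succ k ih =>
    intro j
    rw [catPow, pow_succ', PowerSeries.coeff_mul]
    have h : ∀ p ∈ Finset.HasAntidiagonal.antidiagonal j,
        PowerSeries.coeff p.1 (PowerSeries.mk catalan : PowerSeries ℕ) *
          PowerSeries.coeff p.2 ((PowerSeries.mk catalan : PowerSeries ℕ) ^ k) =
        ∑ t ∈ Finset.Nat.antidiagonalTuple k p.2, catalan p.1 * ∏ i, catalan (t i) := by
      intro p _
      rw [← Finset.mul_sum, ih, PowerSeries.coeff_mk, catPow]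
    rw [Finset.sum_congr rfl h, Finset.sum_sigma']
    refine Finset.sum_bij' (fun t _ => ⟨(t 0, ∑ i, Fin.tail t i), Fin.tail t⟩)
      (fun x _ => Fin.cons x.1.1 x.2) ?_ ?_ ?_ ?_ ?_
    · intro t ht
      rw [Finset.Nat.mem_antidiagonalTuple, Fin.sum_univ_succ] at ht
      simp only [Finset.mem_sigma, Finset.HasAntidiagonal.mem_antidiagonal, Finset.Nat.mem_antidiagonalTuple]
      exact ⟨ht, trivial⟩
    · rintro ⟨⟨a, b⟩, t⟩ hx
      simp only [Finset.mem_sigma, Finset.HasAntidiagonal.mem_antidiagonal,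
        Finset.Nat.mem_antidiagonalTuple] at hx
      rw [Finset.Nat.mem_antidiagonalTuple, Fin.sum_univ_succ]
      simp only [Fin.cons_zero, Fin.cons_succ]
      omega
    · intro t _
      simp
    · rintro ⟨⟨a, b⟩, t⟩ hx
      simp only [Finset.mem_sigma, Finset.HasAntidiagonal.mem_antidiagonal,
        Finset.Nat.mem_antidiagonalTuple] at hx
      simp [hx.2]
    · intro t _
      rw [Fin.prod_univ_succ]
      rfl

theorem colSum_pos (d j : ℕ) : ∀ b s : ℕ, colSum d j (b + s) (b + 1) = catPow j (s + 1) := by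
  induction j with
  | zero => intro b s; simp [colSum, colLists, catPow_zero_left, blobRank]
  | succ j ih =>
    intro b s
    rw [colSum_succ, catPow_sum, Finset.sum_range_succ, add_comm, add_assoc b s 1, ih]
    congr 1
    rw [Finset.sum_Ico_eq_sum_range, ← Finset.sum_range_reflect]
    have : b + (s + 1) - (b + 1) = s := by omega
    rw [this]
    refine Finset.sum_congr rfl fun i hi => ?_
    have hi := Finset.mem_range.1 hi
    rw [if_neg (by omega), if_neg (by omega), one_mul]
    have := ih (b + 1 + (s - 1 - i)) (i + 1)
    rw [← this]
    congr 1
    omega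

theorem colSum_zero (d j : ℕ) : ∀ t : ℕ, colSum d j t 0 =
    ∑ i ∈ Finset.range (j + 1), catPow (j - i) (t + i) * (1 + d) ^ i := by
  induction j with
  | zero => intro t; simp [colSum, colLists, catPow_zero_left, blobRank]
  | succ j ih =>
    intro t
    rw [colSum_succ, Finset.sum_range_succ', Finset.sum_eq_sum_Ico_succ_bot (by omega), ih]
    have h : ∑ c ∈ Finset.Ico (0 + 1) (t + 1), (if c = 0 then d else 1) *
      colSum d j (t + 1) (if c = 0 then 0 else c + 1) = catPow (j + 1) t := by
      rw [catPow_sum, Finset.sum_Ico_eq_sum_range, ← Finset.sum_range_reflect]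
      have : t + 1 - (0 + 1) = t := by omega
      rw [this]
      refine Finset.sum_congr rfl fun i hi => ?_
      have hi := Finset.mem_range.1 hi
      rw [if_neg (by omega), if_neg (by omega), one_mul]
      have := colSum_pos d j (0 + 1 + (t - 1 - i)) (i + 1)
      rw [← this]
      congr 1
      omega
    rw [h, if_pos rfl, if_pos rfl, ih]
    simp only [Nat.sub_zero, add_zero, pow_zero, mul_one]
    rw [← add_assoc, ← one_add_mul, Finset.mul_sum]
    congr 1
    refine Finset.sum_congr rfl fun i hi => ?_
    rw [show j + 1 - (i + 1) = j - i by omega, show t + 1 + i = t + (i + 1) by omega]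
    ring

theorem Omega_eq (n r : ℕ) :
    Omega n r = ((colLists n 0 0).filter (fun l => blobRank l = r)).card := by
  have hnil : ([] : List (ℕ × ℕ)) ∈ colLists n 0 0 := (mem_colLists _ _ _ _).2 ⟨by simp, by simp⟩
  have hset : ∀ l : List (ℕ × ℕ), (IsIndexingMatrix n l ∧ blobRank l = r) ↔
      l ∈ ((colLists n 0 0).filter (fun l => blobRank l = r)).erase [] := by
    intro l
    rw [Finset.mem_erase, Finset.mem_filter]
    constructor
    · rintro ⟨⟨h1, h2, h3, h4⟩, h5⟩
      refine ⟨by rintro rfl; simp at h1, (mem_colLists _ _ _ _).2 ⟨fun p hp => ?_, h4⟩, h5⟩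
      have := h3 p hp
      omega
    · rintro ⟨h1, h2, h3⟩
      have h4 := (mem_colLists _ _ _ _).1 h2
      refine ⟨⟨List.length_pos_iff.2 h1, length_colLists _ _ _ _ h2, fun p hp => ?_, h4.2⟩, h3⟩
      have := h4.1 p hp
      omega
  unfold Omega
  rw [Nat.card_congr (Equiv.subtypeEquivRight hset), Nat.card_eq_fintype_card, Fintype.card_coe,
    Finset.card_erase_eq_ite]
  by_cases hr : r = 0
  · subst hr
    have hm : ([] : List (ℕ × ℕ)) ∈ (colLists n 0 0).filter (fun l => blobRank l = 0) :=
      Finset.mem_filter.2 ⟨hnil, rfl⟩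
    rw [if_pos hm, if_pos rfl]
    have := Finset.card_pos.2 ⟨_, hm⟩
    omega
  · rw [if_neg hr, if_neg]
    · rfl
    · intro h
      exact hr (Finset.mem_filter.1 h).2.symm

/-- for all `d, n ≥ 1`,
`Σ_{k=0}^{n} Ω_k^{(n)} d^k = Σ_{k=1}^{n} χ_k^{(n)} (1+d)^k`. -/
theorem stmt14 (d n : ℕ) (hd : 1 ≤ d) (hn : 1 ≤ n) :
    ∑ k ∈ Finset.range (n + 1), Omega n k * d ^ k =
      ∑ k ∈ Finset.Icc 1 n, chi n k * (1 + d) ^ k := by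
  have h1 : ∑ k ∈ Finset.range (n + 1), Omega n k * d ^ k = colSum d n 0 0 := by
    unfold colSum
    rw [← Finset.sum_fiberwise_of_maps_to (s := colLists n 0 0) (t := Finset.range (n + 1))
      (g := blobRank)]
    · refine Finset.sum_congr rfl fun k _ => ?_
      rw [Omega_eq, Finset.sum_congr rfl (g := fun _ => d ^ k), Finset.sum_const, smul_eq_mul]
      intro l hl
      rw [(Finset.mem_filter.1 hl).2]
    · intro l hl
      have := length_colLists _ _ _ _ hl
      have h2 : blobRank l ≤ l.length := List.countP_le_length
      rw [Finset.mem_range]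
      omega
  rw [h1, colSum_zero, Finset.sum_range_succ']
  obtain ⟨m, rfl⟩ : ∃ m, n = m + 1 := ⟨n - 1, by omega⟩
  rw [Nat.sub_zero, Nat.add_zero, catPow_zero_right, zero_mul, add_zero,
    ← Finset.Ico_add_one_right_eq_Icc, Finset.sum_Ico_eq_sum_range]
  refine Finset.sum_congr (by simp) fun i _ => ?_
  rw [chi, chiSum_eq, zero_add, add_comm 1 i]
end

section
/- The cardinality of the abacus hook monoid ℌ_{d,n} (the connected framed blob monoid) equals d^{n+1} · Σ_{k=0}^{n} Ω_k^{(n)} d^{-k}, equivalently d · Σ_{k=0}^{n} Ω_k^{(n)} d^{n-k}. -/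
open Finset

structure MGood (d m h : ℕ) (f : ℕ → ℕ) (c : ℕ → Option (ZMod d)) : Prop where
  inv : ∀ x, f (f x) = x
  out : ∀ x, m ≤ x → f x = x
  nc : ∀ a b, a < b → b < f a → f b ≠ b ∧ f b < f a
  col : ∀ a, f a ≤ a → c a = some 0
  blob : ∀ a, c a = none → ∀ x, x < a → f x ≠ x ∧ f x < f a
  cnt : #{x ∈ range m | f x = x} = h

theorem MGood.step_fix {d m h : ℕ} {f c} (H : MGood d m h f c) : MGood d (m + 1) (h + 1) f c := by
  obtain ⟨inv, out, nc, col, blob, cnt⟩ := H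
  refine ⟨inv, fun x hx => out x (by omega), nc, col, blob, ?_⟩
  rw [Finset.range_add_one, Finset.filter_insert, if_pos (out m le_rfl), Finset.card_insert_of_notMem (by simp), cnt]

theorem MGood.unstep_fix {d m h : ℕ} {f c} (H : MGood d (m + 1) h f c) (hm : f m = m) :
    ∃ h', h = h' + 1 ∧ MGood d m h' f c := by
  obtain ⟨inv, out, nc, col, blob, cnt⟩ := H
  rw [Finset.range_add_one, Finset.filter_insert, if_pos hm, Finset.card_insert_of_notMem (by simp)] at cnt
  refine ⟨_, cnt.symm, inv, fun x hx => ?_, nc, col, blob, rfl⟩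
  rcases hx.eq_or_lt with rfl | hx
  · exact hm
  · exact out x hx

theorem MGood.lt {d m h : ℕ} {f c} (H : MGood d m h f c) {x : ℕ} (hx : x < m) : f x < m := by
  by_contra hc
  have := H.out _ (not_lt.1 hc)
  have := H.inv x
  omega

theorem MGood.close {d m h j : ℕ} {f : ℕ → ℕ} {c : ℕ → Option (ZMod d)} (H : MGood d m (h + 1) f c) (hj : j < m) (hfj : f j = j)
    (hmax : ∀ x, j < x → x < m → f x ≠ x) (κ : Option (ZMod d)) (hκ : κ = none → h = 0) :
    MGood d (m + 1) h (Function.update (Function.update f m j) j m) (Function.update c j κ) := by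
  have hlt := @H.lt
  obtain ⟨inv, out, nc, col, blob, cnt⟩ := H
  have hm := out m le_rfl
  have key : h = 0 → ∀ x, x < m → f x = x → x = j := by
    intro h0 x hx hfx
    subst h0
    obtain ⟨y, hy⟩ := Finset.card_eq_one.1 cnt
    have h1 : x ∈ ({y} : Finset ℕ) := by rw [← hy]; simp [hx, hfx]
    have h2 : j ∈ ({y} : Finset ℕ) := by rw [← hy]; simp [hj, hfj]
    simp at h1 h2
    omega
  have nj : ∀ x, x < j → f x < j := by
    intro x hx
    by_contra hc
    have : f x ≠ j := by intro h; have := inv x; grind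
    have := nc x j hx (by omega)
    exact this.1 hfj
  constructor
  · intro x
    simp only [Function.update_apply]
    grind
  · intro x hx
    simp only [Function.update_apply]
    grind
  · intro a b hab
    simp only [Function.update_apply]
    have := nc a b hab
    grind
  · intro a
    simp only [Function.update_apply]
    have := col a
    grind
  · intro a ha x hxa
    simp only [Function.update_apply] at *
    by_cases haj : a = j
    · subst haj
      have := key (hκ (by simpa using ha)) x (by omega)
      grind
    · rw [if_neg haj] at ha
      have := blob a ha x hxa
      have := blob a ha j
      have : f a ≠ a := by
        intro h
        have := col a h.le
        simp [ha] at this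
      have := @hlt a
      grind
  · have : {x ∈ range (m+1) | Function.update (Function.update f m j) j m x = x} = ({x ∈ range m | f x = x}).erase j := by
      ext x
      simp only [Finset.mem_filter, Finset.mem_range, Finset.mem_erase, Function.update_apply]
      grind
    rw [this, Finset.card_erase_of_mem (by simp [hj, hfj]), cnt]
    rfl

theorem MGood.opn {d m h : ℕ} {f : ℕ → ℕ} {c : ℕ → Option (ZMod d)} (H : MGood d (m + 1) h f c) (hm : f m ≠ m) :
    f m < m ∧ (∀ x, f m < x → x < m → f x ≠ x) ∧ (c (f m) = none → h = 0) ∧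
    MGood d m (h + 1) (Function.update (Function.update f m m) (f m) (f m)) (Function.update c (f m) (some 0)) := by
  have hlt := @H.lt
  obtain ⟨inv, out, nc, col, blob, cnt⟩ := H
  have hj : f m < m := by have := @hlt m; omega
  have hjm := inv m
  generalize hjj : f m = j at *
  have hmx : ∀ x, j < x → x < m → f x ≠ x := fun x h1 h2 => (nc j x h1 (by omega)).1
  have nj : ∀ x, x < j → f x < j := by
    intro x hx
    by_contra hc
    have : f x ≠ j := by intro h; have := inv x; grind
    have := nc x j hx (by omega)
    have := @hlt x
    omega
  refine ⟨hj, hmx, ?_, ?_⟩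
  · intro hc
    rw [← cnt, Finset.card_eq_zero, Finset.filter_eq_empty_iff]
    intro x hx hfx
    have := blob j hc x
    simp at hx
    grind
  constructor
  · intro x
    have h1 : f x = j → x = m := by intro h; rw [← inv x, h, hjm]
    have h2 : f x = m → x = j := by intro h; rw [← inv x, h, hjj]
    have h3 := inv x
    clear nc blob hmx nj inv out col hlt cnt
    simp only [Function.update_apply]
    grind
  · intro x hx
    have h1 := out x
    clear nc blob hmx nj inv out col hlt cnt
    simp only [Function.update_apply]
    grind
  · intro a b hab
    simp only [Function.update_apply]
    have h1 := nc a b hab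
    have h2 := @hlt a
    have h3 := nj a
    clear nc blob hmx nj inv out col hlt cnt
    grind
  · intro a
    simp only [Function.update_apply]
    have h1 := col a
    clear nc blob hmx nj inv out col hlt cnt
    grind
  · intro a ha x hxa
    simp only [Function.update_apply] at *
    have haj : a ≠ j := by rintro rfl; simp at ha
    rw [if_neg haj] at ha
    have h1 := blob a ha x hxa
    have h2 := blob a ha j
    have h3 : f a ≠ a := by
      intro h
      have := col a h.le
      simp [ha] at this
    have h4 := @hlt a
    have h5 := out a
    have h6 : a ≠ m := by
      rintro rfl
      have := col a (by omega)
      simp [ha] at this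
    clear nc blob hmx nj inv out col hlt cnt
    grind
  · have : {x ∈ range m | Function.update (Function.update f m m) j j x = x} = insert j ({x ∈ range (m+1) | f x = x}) := by
      ext x
      simp only [Finset.mem_filter, Finset.mem_range, Finset.mem_insert, Function.update_apply]
      clear nc blob hmx nj inv out col hlt cnt
      grind
    rw [this, Finset.card_insert_of_notMem (by simp; omega), cnt]

/-- Weighted path counts. -/
def Nd (d : ℕ) : ℕ → ℕ → ℕ
  | 0, 0 => 1
  | 0, _ + 1 => 0
  | m + 1, 0 => (d + 1) * Nd d m 1
  | m + 1, h + 1 => Nd d m h + d * Nd d m (h + 2)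

def MS (d m h : ℕ) : Set ((ℕ → ℕ) × (ℕ → Option (ZMod d))) := {y | MGood d m h y.1 y.2}

/-- the largest fixed point below `m` -/
def lastFix (f : ℕ → ℕ) (m : ℕ) : ℕ := ({x ∈ range m | f x = x}).sup id

theorem lastFix_spec {d m h : ℕ} {f c} (H : MGood d m (h + 1) f c) :
    lastFix f m < m ∧ f (lastFix f m) = lastFix f m ∧ ∀ x, lastFix f m < x → x < m → f x ≠ x := by
  have hne : ({x ∈ range m | f x = x}).Nonempty := by
    rw [← Finset.card_pos, H.cnt]; omega
  obtain ⟨y, hy, hy2⟩ := Finset.exists_mem_eq_sup _ hne id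
  have e : lastFix f m = y := hy2
  rw [e]
  simp only [Finset.mem_filter, Finset.mem_range] at hy
  refine ⟨hy.1, hy.2, fun x h1 h2 h3 => ?_⟩
  have : x ≤ lastFix f m := Finset.le_sup (f := id) (by simp [h2, h3])
  omega

theorem lastFix_eq {f : ℕ → ℕ} {m j : ℕ} (h1 : j < m) (h2 : f j = j) (h3 : ∀ x, j < x → x < m → f x ≠ x) :
    lastFix f m = j := by
  apply le_antisymm
  · apply Finset.sup_le
    intro x hx
    simp only [Finset.mem_filter, Finset.mem_range] at hx
    by_contra hc
    exact h3 x (not_le.1 hc) hx.1 hx.2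
  · exact Finset.le_sup (f := id) (by simp [h1, h2])

def closeMap (d m : ℕ) (y : ((ℕ → ℕ) × (ℕ → Option (ZMod d))) × Option (ZMod d)) :
    (ℕ → ℕ) × (ℕ → Option (ZMod d)) :=
  (Function.update (Function.update y.1.1 m (lastFix y.1.1 m)) (lastFix y.1.1 m) m,
    Function.update y.1.2 (lastFix y.1.1 m) y.2)

def openMap (d m : ℕ) (y : (ℕ → ℕ) × (ℕ → Option (ZMod d))) :
    ((ℕ → ℕ) × (ℕ → Option (ZMod d))) × Option (ZMod d) :=
  ((Function.update (Function.update y.1 m m) (y.1 m) (y.1 m), Function.update y.2 (y.1 m) (some 0)), y.2 (y.1 m))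

def MS' (d m h : ℕ) : Set ((ℕ → ℕ) × (ℕ → Option (ZMod d))) := {y | MGood d m h y.1 y.2 ∧ ∃ x, m = x + 1 ∧ y.1 x ≠ x}

def KS (d h : ℕ) : Set (Option (ZMod d)) := {κ | κ = none → h = 0}

theorem MS'_encard (d m h : ℕ) :
    (MS' d (m + 1) h).encard = (MS d m (h + 1)).encard * (KS d h).encard := by
  rw [← Set.encard_prod]
  symm
  have hmaps : ∀ y ∈ MS d m (h + 1) ×ˢ KS d h, closeMap d m y ∈ MS' d (m + 1) h := by
    rintro ⟨⟨f, c⟩, κ⟩ ⟨h1, h2⟩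
    obtain ⟨a1, a2, a3⟩ := lastFix_spec h1
    refine ⟨MGood.close h1 a1 a2 a3 κ h2, m, rfl, ?_⟩
    simp only [closeMap]
    rw [Function.update_of_ne a1.ne', Function.update_self]
    exact a1.ne
  have hleft : ∀ y ∈ MS d m (h + 1) ×ˢ KS d h, openMap d m (closeMap d m y) = y := by
    rintro ⟨⟨f, c⟩, κ⟩ ⟨h1, h2⟩
    obtain ⟨a1, a2, a3⟩ := lastFix_spec h1
    have e1 : f m = m := MGood.out h1 m le_rfl
    have e2 : c (lastFix f m) = some 0 := MGood.col h1 _ a2.le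
    simp only [] at a1 a2 a3
    simp only [openMap, closeMap]
    generalize lastFix f m = j at *
    rw [Function.update_of_ne a1.ne', Function.update_self]
    simp only [Prod.mk.injEq]
    refine ⟨⟨?_, ?_⟩, ?_⟩
    · funext x
      simp only [Function.update_apply]
      split_ifs <;> simp_all
    · funext x
      simp only [Function.update_apply]
      split_ifs <;> simp_all
    · simp
  have hright : ∀ y ∈ MS' d (m + 1) h, openMap d m y ∈ MS d m (h + 1) ×ˢ KS d h ∧ closeMap d m (openMap d m y) = y := by
    rintro ⟨f, c⟩ ⟨h1, x, hx, h2⟩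
    obtain rfl : m = x := by omega
    obtain ⟨a1, a2, a3, a4⟩ := h1.opn h2
    refine ⟨⟨a4, a3⟩, ?_⟩
    have e1 := h1.inv m
    simp only [] at a1 a2 a3 e1
    have : lastFix (Function.update (Function.update f m m) (f m) (f m)) m = f m := by
      apply lastFix_eq a1 (by simp)
      intro x b1 b2
      rw [Function.update_of_ne b1.ne', Function.update_of_ne b2.ne]
      exact a2 x b1 b2
    simp only [openMap, closeMap, this]
    simp only [Prod.mk.injEq]
    refine ⟨?_, ?_⟩
    · funext x
      simp only [Function.update_apply]
      split_ifs <;> simp_all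
    · simp
  have himg : closeMap d m '' (MS d m (h + 1) ×ˢ KS d h) = MS' d (m + 1) h := by
    ext y
    constructor
    · rintro ⟨z, hz, rfl⟩
      exact hmaps z hz
    · intro hy
      exact ⟨_, (hright y hy).1, (hright y hy).2⟩
  rw [← himg]
  refine (Set.InjOn.encard_image ?_).symm
  intro a ha b hb hab
  rw [← hleft a ha, hab, hleft b hb]

theorem KS_zero (d : ℕ) (hd : 1 ≤ d) : (KS d 0).encard = ((d + 1 : ℕ) : ℕ∞) := by
  have : NeZero d := ⟨by omega⟩
  have : KS d 0 = Set.univ := by ext; simp [KS]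
  rw [this, Set.encard_univ, ENat.card_eq_coe_fintype_card, Fintype.card_option, ZMod.card]

theorem KS_succ (d h : ℕ) (hd : 1 ≤ d) : (KS d (h + 1)).encard = (d : ℕ∞) := by
  have : NeZero d := ⟨by omega⟩
  have : KS d (h + 1) = Set.range some := by ext x; cases x <;> simp [KS]
  rw [this, ← Set.image_univ, (Option.some_injective _).encard_image, Set.encard_univ, ENat.card_eq_coe_fintype_card, ZMod.card]

theorem MS_encard (d : ℕ) (hd : 1 ≤ d) (m h : ℕ) : (MS d m h).encard = (Nd d m h : ℕ∞) := by
  induction m generalizing h with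
  | zero =>
    cases h with
    | zero =>
      have : MS d 0 0 = {(id, fun _ => some 0)} := by
        ext ⟨f, c⟩
        simp only [MS, Set.mem_ofPred_eq, Set.mem_singleton_iff, Prod.mk.injEq]
        constructor
        · intro H
          have : f = id := by funext x; exact H.out x (Nat.zero_le _)
          exact ⟨this, by funext x; exact H.col x (by rw [this]; rfl)⟩
        · rintro ⟨rfl, rfl⟩
          constructor <;> simp
          intros; omega
      rw [this]; simp [Nd]
    | succ h =>
      have : MS d 0 (h + 1) = ∅ := by
        ext ⟨f, c⟩
        simp only [MS, Set.mem_ofPred_eq, Set.mem_empty_iff_false, iff_false]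
        intro H
        have := H.cnt
        simp at this
      rw [this]; simp [Nd]
  | succ m ih =>
    cases h with
    | zero =>
      have : MS d (m + 1) 0 = MS' d (m + 1) 0 := by
        ext ⟨f, c⟩
        simp only [MS, MS', Set.mem_ofPred_eq]
        constructor
        · intro H
          refine ⟨H, m, rfl, fun hm => ?_⟩
          obtain ⟨h', h1, -⟩ := H.unstep_fix hm
          omega
        · exact fun H => H.1
      rw [this, MS'_encard, ih, KS_zero d hd]
      simp only [Nd]
      push_cast
      ring
    | succ h =>
      have : MS d (m + 1) (h + 1) = MS d m h ∪ MS' d (m + 1) (h + 1) := by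
        ext ⟨f, c⟩
        simp only [MS, MS', Set.mem_ofPred_eq, Set.mem_union]
        constructor
        · intro H
          by_cases hm : f m = m
          · obtain ⟨h', h1, h2⟩ := H.unstep_fix hm
            obtain rfl : h = h' := by omega
            exact Or.inl h2
          · exact Or.inr ⟨H, m, rfl, hm⟩
        · rintro (H | H)
          · exact H.step_fix
          · exact H.1
      rw [this, Set.encard_union_eq, MS'_encard, ih, ih, KS_succ d h hd]
      · simp only [Nd]
        push_cast
        ring
      · rw [Set.disjoint_left]
        rintro ⟨f, c⟩ H ⟨-, x, hx, h2⟩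
        obtain rfl : m = x := by omega
        exact h2 (MGood.out H m le_rfl)

open Classical in
noncomputable def hookEquiv (d n : ℕ) : AbacusHookDiagram d n ≃ (MS d (2 * n) 0) × ZMod d where
  toFun D := (⟨(fun x => if h : x < 2 * n then (D.base.f ⟨x, h⟩ : ℕ) else x,
      fun x => if h : x < 2 * n then (if D.blob ⟨x, h⟩ then none else some (D.beads ⟨x, h⟩)) else some 0), by
    obtain ⟨⟨f, inv, nof, nc⟩, blob, hb, beads, hbe, k⟩ := D
    simp only [TLDiagram.IsExposed, TLDiagram.IsArc] at hb hbe
    constructor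
    · intro x
      by_cases h : x < 2 * n <;> simp [h, inv]
    · intro x hx
      simp [not_lt.2 hx]
    · intro a b hab
      by_cases h : a < 2 * n
      · simp only [h, dite_true]
        intro hb
        have hb' : b < 2 * n := hb.trans (f ⟨a, h⟩).2
        simp only [hb', dite_true]
        have h1 := nc ⟨a, h⟩ ⟨b, hb'⟩ hab hb
        have h2 := nof ⟨b, hb'⟩
        refine ⟨fun h => h2 (Fin.ext h), ?_⟩
        by_contra hc
        rcases (not_lt.1 hc).eq_or_lt with h3 | h3
        · have h4 := congrArg f (Fin.ext h3)
          rw [inv, inv] at h4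
          simp at h4
          omega
        · exact h1 h3
      · simp only [h, dite_false]; omega
    · intro a
      by_cases h : a < 2 * n
      · simp only [h, dite_true]
        intro h1
        have h2 : ¬ (⟨a, h⟩ : Fin (2 * n)) < f ⟨a, h⟩ := not_lt.2 h1
        have h3 : blob ⟨a, h⟩ = false := by
          by_contra hc
          exact h2 (hb ⟨a, h⟩ (by simpa using hc)).1
        simp [h3, hbe _ (Or.inl h2)]
      · simp [h]
    · intro a
      by_cases h : a < 2 * n
      · simp only [h, dite_true]
        intro h1 x hx
        have h2 : blob ⟨a, h⟩ = true := by
          by_contra hc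
          simp [hc] at h1
        simp only [hx.trans h, dite_true]
        have h3 := (hb _ h2).2 ⟨x, hx.trans h⟩
        refine ⟨fun h => nof _ (Fin.ext h), ?_⟩
        by_contra hc
        rcases (not_lt.1 hc).eq_or_lt with h4 | h4
        · have h4 := congrArg f (Fin.ext h4)
          rw [inv, inv] at h4
          simp at h4
          omega
        · exact h3 ⟨hx, h4⟩
      · simp [h]
    · rw [Finset.card_eq_zero, Finset.filter_eq_empty_iff]
      intro x hx h
      simp only [Finset.mem_range] at hx
      simp only [hx, dite_true] at h
      exact nof _ (Fin.ext h)⟩, D.hookBeads)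
  invFun z :=
    { base :=
        { f := fun x => ⟨z.1.1.1 x, MGood.lt z.1.2 x.2⟩
          involutive := fun x => Fin.ext (z.1.2.inv _)
          noFixedPoint := fun x h => by
            have := z.1.2.cnt
            rw [Finset.card_eq_zero, Finset.filter_eq_empty_iff] at this
            exact this (x := (x : ℕ)) (by simp) (congrArg Fin.val h)
          noncrossing := fun a b h1 h2 h3 => by
            have := z.1.2.nc a b h1 h2
            exact absurd this.2 (not_lt.2 (le_of_lt h3)) }
      blob := fun x => z.1.1.2 x == none
      blob_exposed := fun a ha => by
        have ha' : z.1.1.2 a = none := by simpa using ha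
        refine ⟨?_, fun c hc => ?_⟩
        · by_contra hc
          have := z.1.2.col a (not_lt.1 hc)
          simp [ha'] at this
        · have := z.1.2.blob a ha' c hc.1
          exact absurd this.2 (not_lt.2 (le_of_lt hc.2))
      beads := fun x => (z.1.1.2 x).getD 0
      beads_arc := fun a ha => by
        rcases ha with ha | ha
        · have := z.1.2.col a (not_lt.1 ha)
          simp [this]
        · have ha' : z.1.1.2 a = none := by simpa using ha
          simp [ha']
      hookBeads := z.2 }
  left_inv D := by
    obtain ⟨⟨f, inv, nof, nc⟩, blob, hb, beads, hbe, k⟩ := D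
    simp only [AbacusHookDiagram.mk.injEq, TLDiagram.mk.injEq, and_true]
    refine ⟨?_, ?_, ?_⟩
    · funext x; simp
    · funext x; simp; cases blob x <;> simp
    · funext x; simp
      split_ifs with h
      · simp [hbe x (Or.inr h)]
      · simp
  right_inv z := by
    obtain ⟨⟨⟨f, c⟩, H⟩, k⟩ := z
    have H' : MGood d (2 * n) 0 f c := H
    simp only [Prod.mk.injEq, Subtype.mk.injEq, and_true]
    refine ⟨?_, ?_⟩
    · funext x
      split_ifs with h
      · rfl
      · exact (H'.out x (not_lt.1 h)).symm
    · funext x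
      split_ifs with h h2
      · symm; simpa using h2
      · cases hc : c x <;> simp_all
      · exact (H'.col x (by rw [H'.out x (not_lt.1 h)])).symm

theorem hook_card (d n : ℕ) (hd : 1 ≤ d) : Nat.card (AbacusHookDiagram d n) = d * Nd d (2 * n) 0 := by
  rw [Nat.card_congr (hookEquiv d n), Nat.card_prod, Nat.card_zmod, mul_comm]
  congr 1
  have := MS_encard d hd (2 * n) 0
  rw [Nat.card_coe_set_eq, Set.ncard, this]
  rfl

/-- Ballot path counts. -/
def PP : ℕ → ℕ → ℕ
  | 0, 0 => 1
  | 0, _ + 1 => 0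
  | m + 1, 0 => PP m 1
  | m + 1, h + 1 => PP m h + PP m (h + 2)

theorem PP_zero (m h : ℕ) (hm : m < h) : PP m h = 0 := by
  induction m generalizing h with
  | zero => cases h <;> simp_all [PP]
  | succ m ih =>
    cases h with
    | zero => omega
    | succ h => simp only [PP]; rw [ih _ (by omega), ih _ (by omega)]

theorem Nd_zero (d m h : ℕ) (hm : m < h) : Nd d m h = 0 := by
  induction m generalizing h with
  | zero => cases h <;> simp_all [Nd]
  | succ m ih =>
    cases h with
    | zero => omega
    | succ h => simp only [Nd]; rw [ih _ (by omega), ih _ (by omega)]; simp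

theorem Nd_eq (d m : ℕ) : ∀ h j, m = h + 2 * j →
    Nd d m h = ∑ k ∈ range (j + 1), PP m (h + 2 * k) * d ^ (j - k) := by
  induction m with
  | zero =>
    intro h j e
    obtain rfl : h = 0 := by omega
    obtain rfl : j = 0 := by omega
    simp [Nd, PP]
  | succ m ih =>
    intro h j e
    cases h with
    | zero =>
      obtain ⟨j, rfl⟩ : ∃ i, j = i + 1 := ⟨j - 1, by omega⟩
      have h1 := ih 1 j (by omega)
      have h2 : ∑ k ∈ range (j + 1), PP m (2 * k + 3) * d ^ (j - k)
          = ∑ k ∈ range j, PP m (2 * k + 3) * d ^ (j - k) := by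
        rw [Finset.sum_range_succ, PP_zero m (2 * j + 3) (by omega)]; simp
      have h3 : d * ∑ k ∈ range (j + 1), PP m (1 + 2 * k) * d ^ (j - k)
          = (∑ k ∈ range j, PP m (2 * k + 3) * d ^ (j - k)) + PP m 1 * d ^ (j + 1) := by
        rw [Finset.sum_range_succ', mul_add, Finset.mul_sum]
        congr 1
        · apply Finset.sum_congr rfl
          intro k hk
          simp only [Finset.mem_range] at hk
          have : j - k = j - (k + 1) + 1 := by omega
          rw [this, show 1 + 2 * (k + 1) = 2 * k + 3 by ring]
          ring
        · simp; ring
      rw [Finset.sum_range_succ']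
      simp only [Nd]
      rw [add_mul, one_mul, h1, h3]
      have h4 : ∑ k ∈ range (j + 1), PP (m + 1) (0 + 2 * (k + 1)) * d ^ (j + 1 - (k + 1))
          = ∑ k ∈ range (j + 1), PP m (1 + 2 * k) * d ^ (j - k) + ∑ k ∈ range (j + 1), PP m (2 * k + 3) * d ^ (j - k) := by
        rw [← Finset.sum_add_distrib]
        apply Finset.sum_congr rfl
        intro k hk
        rw [show 0 + 2 * (k + 1) = (2 * k + 1) + 1 by ring, Nat.add_sub_add_right]
        simp only [PP]
        rw [add_comm 1 (2 * k)]
        ring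
      rw [h4, h2]
      simp only [PP, mul_zero, add_zero, Nat.sub_zero]
      ring
    | succ h =>
      have h1 := ih h j (by omega)
      have h4 : ∑ k ∈ range (j + 1), PP (m + 1) (h + 1 + 2 * k) * d ^ (j - k)
          = ∑ k ∈ range (j + 1), PP m (h + 2 * k) * d ^ (j - k) + ∑ k ∈ range (j + 1), PP m (h + 2 + 2 * k) * d ^ (j - k) := by
        rw [← Finset.sum_add_distrib]
        apply Finset.sum_congr rfl
        intro k hk
        rw [show h + 1 + 2 * k = (h + 2 * k) + 1 by ring]
        simp only [PP]
        rw [show h + 2 + 2 * k = h + 2 * k + 2 by ring]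
        ring
      rw [h4]
      simp only [Nd]
      rw [h1]
      congr 1
      rw [Finset.sum_range_succ, PP_zero m (h + 2 + 2 * j) (by omega), zero_mul, add_zero]
      cases j with
      | zero => rw [Nd_zero _ _ _ (by omega)]; simp
      | succ j =>
        rw [ih (h + 2) j (by omega), Finset.mul_sum]
        apply Finset.sum_congr rfl
        intro k hk
        simp only [Finset.mem_range] at hk
        have : j + 1 - k = j - k + 1 := by omega
        rw [this]; ring

def Dom : List ℕ → List ℕ → Prop
  | _, [] => True
  | [], _ :: _ => False
  | t :: T, b :: B => b ≤ t ∧ Dom T B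

theorem Dom.append_left (x : ℕ) : ∀ {T B : List ℕ}, Dom T B → Dom (T ++ [x]) B
  | [], [], _ => by simp [Dom]
  | _ :: _, [], _ => by simp [Dom]
  | [], _ :: _, h => by simp [Dom] at h
  | t :: T, b :: B, h => by
    simp only [List.cons_append, Dom] at h ⊢
    exact ⟨h.1, Dom.append_left x h.2⟩

theorem Dom.of_append_left (s : ℕ) : ∀ {T B : List ℕ}, (∀ b ∈ B, s < b) → Dom (T ++ [s]) B → Dom T B
  | [], [], _, _ => by simp [Dom]
  | _ :: _, [], _, _ => by simp [Dom]
  | [], b :: _, h, h' => by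
    simp [Dom] at h h'
    omega
  | t :: T, b :: B, h, h' => by
    simp only [List.cons_append, Dom] at h' ⊢
    exact ⟨h'.1, Dom.of_append_left s (fun b hb => h b (by simp [hb])) h'.2⟩

theorem Dom.length_le : ∀ {T B : List ℕ}, Dom T B → B.length ≤ T.length
  | [], [], _ => by simp
  | _ :: _, [], _ => by simp
  | [], _ :: _, h => by simp [Dom] at h
  | t :: T, b :: B, h => by
    simp only [Dom] at h
    simpa using Dom.length_le h.2

theorem Dom.append_right (s : ℕ) : ∀ {T B : List ℕ}, (∀ t ∈ T, s ≤ t) → B.length < T.length → Dom T B → Dom T (B ++ [s])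
  | [], _, _, hl, _ => by simp at hl
  | t :: T, [], h, _, _ => by simp [Dom]; exact h t (by simp)
  | t :: T, b :: B, h, hl, h' => by
    simp only [List.cons_append, Dom] at h' ⊢
    exact ⟨h'.1, Dom.append_right s (fun b hb => h b (by simp [hb])) (by simpa using hl) h'.2⟩

theorem Dom.of_append_right (s : ℕ) : ∀ {T B : List ℕ}, Dom T (B ++ [s]) → Dom T B
  | _, [], _ => by simp [Dom]
  | [], _ :: _, h => by simp [Dom] at h
  | t :: T, b :: B, h => by
    simp only [List.cons_append, Dom] at h ⊢
    exact ⟨h.1, Dom.of_append_right s h.2⟩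

structure XGood (N s u h : ℕ) (T B : List ℕ) : Prop where
  sT : T.Pairwise (· > ·)
  sB : B.Pairwise (· > ·)
  bT : ∀ t ∈ T, s ≤ t ∧ t < N
  bB : ∀ b ∈ B, u ≤ b ∧ b < N
  dom : Dom T B
  len : T.length = B.length + h

def XS (N s u h : ℕ) : Set (List ℕ × List ℕ) := {y | XGood N s u h y.1 y.2}

theorem desc_cases {T : List ℕ} {s N : ℕ} (hT : T.Pairwise (· > ·)) (hb : ∀ t ∈ T, s ≤ t ∧ t < N) :
    (∀ t ∈ T, s + 1 ≤ t ∧ t < N) ∨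
    ∃ T', T = T' ++ [s] ∧ T'.Pairwise (· > ·) ∧ ∀ t ∈ T', s + 1 ≤ t ∧ t < N := by
  rcases List.eq_nil_or_concat T with rfl | ⟨T', x, rfl⟩
  · left; simp
  · rw [List.concat_eq_append] at *
    rw [List.pairwise_append] at hT
    have hx := hb x (by simp)
    have h1 : ∀ t ∈ T', x < t ∧ t < N := fun t ht => ⟨hT.2.2 t ht x (by simp), (hb t (by simp [ht])).2⟩
    by_cases hs : x = s
    · subst hs
      exact Or.inr ⟨T', rfl, hT.1, fun t ht => h1 t ht⟩
    · left
      intro t ht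
      simp only [List.mem_append, List.mem_singleton] at ht
      rcases ht with ht | rfl
      · have := h1 t ht; omega
      · omega

theorem desc_append {T : List ℕ} {s N : ℕ} (hT : T.Pairwise (· > ·)) (hb : ∀ t ∈ T, s + 1 ≤ t ∧ t < N) (hs : s < N) :
    (T ++ [s]).Pairwise (· > ·) ∧ ∀ t ∈ T ++ [s], s ≤ t ∧ t < N := by
  rw [List.pairwise_append]
  refine ⟨⟨hT, by simp, ?_⟩, ?_⟩
  · intro a ha b hb'
    simp only [List.mem_singleton] at hb'
    have := hb a ha
    omega
  · intro t ht
    simp only [List.mem_append, List.mem_singleton] at ht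
    rcases ht with ht | rfl
    · have := hb t ht; omega
    · omega

theorem XS_half_zero {N s : ℕ} : XS N s (s + 1) 0 = XS N (s + 1) (s + 1) 0 := by
  ext ⟨T, B⟩
  constructor
  · rintro ⟨sT, sB, bT, bB, dom, len⟩
    refine ⟨sT, sB, ?_, bB, dom, len⟩
    rcases desc_cases sT bT with h | ⟨T', rfl, h1, h2⟩
    · exact h
    · have := (Dom.of_append_left s (fun b hb => (bB b hb).1) dom).length_le
      simp at len this
      omega
  · rintro ⟨sT, sB, bT, bB, dom, len⟩
    exact ⟨sT, sB, fun t ht => ⟨by have := bT t ht; omega, (bT t ht).2⟩, bB, dom, len⟩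

theorem XS_half_succ {N s h : ℕ} (hs : s < N) : (XS N s (s + 1) (h + 1)).encard =
    (XS N (s + 1) (s + 1) (h + 1)).encard + (XS N (s + 1) (s + 1) h).encard := by
  have : XS N s (s + 1) (h + 1) = XS N (s + 1) (s + 1) (h + 1) ∪
      (fun y : List ℕ × List ℕ => (y.1 ++ [s], y.2)) '' XS N (s + 1) (s + 1) h := by
    ext ⟨T, B⟩
    constructor
    · rintro ⟨sT, sB, bT, bB, dom, len⟩
      rcases desc_cases sT bT with h | ⟨T', rfl, h1, h2⟩
      · exact Or.inl ⟨sT, sB, h, bB, dom, len⟩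
      · refine Or.inr ⟨(T', B), ⟨h1, sB, h2, bB, Dom.of_append_left s (fun b hb => (bB b hb).1) dom, ?_⟩, rfl⟩
        simp at len
        simp; omega
    · rintro (⟨sT, sB, bT, bB, dom, len⟩ | ⟨⟨T', B'⟩, ⟨sT, sB, bT, bB, dom, len⟩, h⟩)
      · exact ⟨sT, sB, fun t ht => ⟨by have := bT t ht; omega, (bT t ht).2⟩, bB, dom, len⟩
      · simp only [Prod.mk.injEq] at h
        obtain ⟨rfl, rfl⟩ := h
        obtain ⟨h1, h2⟩ := desc_append sT bT hs
        refine ⟨h1, sB, h2, bB, Dom.append_left s dom, ?_⟩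
        simp at len ⊢
        omega
  rw [this, Set.encard_union_eq, Set.InjOn.encard_image]
  · rintro ⟨T, B⟩ - ⟨T', B'⟩ - h
    simpa using h
  · rw [Set.disjoint_left]
    rintro _ h1 ⟨⟨T', B'⟩, -, rfl⟩
    have := (XGood.bT h1 s (by simp)).1
    omega

theorem XS_full {N s h : ℕ} (hs : s < N) : (XS N s s h).encard =
    (XS N s (s + 1) h).encard + (XS N s (s + 1) (h + 1)).encard := by
  have : XS N s s h = XS N s (s + 1) h ∪
      (fun y : List ℕ × List ℕ => (y.1, y.2 ++ [s])) '' XS N s (s + 1) (h + 1) := by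
    ext ⟨T, B⟩
    constructor
    · rintro ⟨sT, sB, bT, bB, dom, len⟩
      rcases desc_cases sB bB with h | ⟨T', rfl, h1, h2⟩
      · exact Or.inl ⟨sT, sB, bT, h, dom, len⟩
      · refine Or.inr ⟨(T, T'), ⟨sT, h1, bT, h2, Dom.of_append_right s dom, ?_⟩, rfl⟩
        simp at len
        simp; omega
    · rintro (⟨sT, sB, bT, bB, dom, len⟩ | ⟨⟨T', B'⟩, ⟨sT, sB, bT, bB, dom, len⟩, h⟩)
      · exact ⟨sT, sB, bT, fun t ht => ⟨by have := bB t ht; omega, (bB t ht).2⟩, dom, len⟩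
      · simp only [Prod.mk.injEq] at h
        obtain ⟨rfl, rfl⟩ := h
        obtain ⟨h1, h2⟩ := desc_append sB bB hs
        simp only at len
        refine ⟨sT, h1, bT, h2, Dom.append_right s (fun t ht => (bT t ht).1) (by show B'.length < T'.length; omega) dom, ?_⟩
        simp at len ⊢
        omega
  rw [this, Set.encard_union_eq, Set.InjOn.encard_image]
  · rintro ⟨T, B⟩ - ⟨T', B'⟩ - h
    simpa using h
  · rw [Set.disjoint_left]
    rintro _ h1 ⟨⟨T', B'⟩, -, rfl⟩
    have := (XGood.bB h1 s (by simp)).1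
    omega

theorem XS_half_count {N s n : ℕ} (e : s + n + 1 = N)
    (ih : ∀ h, (XS N (s + 1) (s + 1) h).encard = (PP (2 * n + 1) (2 * h + 1) : ℕ∞)) (h : ℕ) :
    (XS N s (s + 1) h).encard = (PP (2 * n + 2) (2 * h) : ℕ∞) := by
  cases h with
  | zero => rw [XS_half_zero, ih]; simp [PP]
  | succ h =>
    have h1 : PP (2 * n + 2) (2 * (h + 1)) = PP (2 * n + 1) (2 * h + 1) + PP (2 * n + 1) (2 * (h + 1) + 1) := rfl
    rw [XS_half_succ (by omega), ih, ih, h1]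
    push_cast
    rw [add_comm]

theorem XS_count (N : ℕ) : ∀ n s, s + n = N → ∀ h, (XS N s s h).encard = (PP (2 * n + 1) (2 * h + 1) : ℕ∞) := by
  intro n
  induction n with
  | zero =>
    rintro s rfl h
    cases h with
    | zero =>
      have : XS (s + 0) s s 0 = {([], [])} := by
        ext ⟨T, B⟩
        simp only [Set.mem_singleton_iff, Prod.mk.injEq]
        constructor
        · intro H
          exact ⟨List.eq_nil_iff_forall_not_mem.2 fun t ht => by have := H.bT t ht; omega,
            List.eq_nil_iff_forall_not_mem.2 fun t ht => by have := H.bB t ht; omega⟩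
        · rintro ⟨rfl, rfl⟩
          constructor <;> simp [Dom]
      rw [this]; simp [PP]
    | succ h =>
      have : XS (s + 0) s s (h + 1) = ∅ := by
        ext ⟨T, B⟩
        simp only [Set.mem_empty_iff_false, iff_false]
        intro H
        have h1 : T = [] := List.eq_nil_iff_forall_not_mem.2 fun t ht => by have := H.bT t ht; omega
        have := H.len
        simp [h1] at this
      rw [this, PP_zero _ _ (by omega)]; simp
  | succ n ih =>
    intro s e h
    have h1 := XS_half_count (N := N) (s := s) (n := n) (by omega) (ih (s + 1) (by omega))
    rw [XS_full (by omega), h1, h1, show 2 * (n + 1) + 1 = (2 * n + 2) + 1 by ring, PP,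
      show 2 * (h + 1) = 2 * h + 2 by ring]
    push_cast
    rfl

theorem XS_omega (n r : ℕ) (hn : 1 ≤ n) : (XS n 0 1 r).encard = (PP (2 * n) (2 * r) : ℕ∞) := by
  obtain ⟨n, rfl⟩ : ∃ i, n = i + 1 := ⟨n - 1, by omega⟩
  exact XS_half_count (N := n + 1) (s := 0) (n := n) (by omega) (XS_count (n + 1) n (0 + 1) (by omega)) r

def mergeCols : List ℕ → List ℕ → List (ℕ × ℕ)
  | [], _ => []
  | t :: T, [] => (t, 0) :: mergeCols T []
  | t :: T, b :: B => (t, b) :: mergeCols T B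

def splitCols (l : List (ℕ × ℕ)) : List ℕ × List ℕ :=
  (l.map Prod.fst, (l.map Prod.snd).filter (fun x => x ≠ 0))

def DRel (q p : ℕ × ℕ) : Prop := p.1 < q.1 ∧ p.2 ≤ q.2 ∧ (p.2 = q.2 → p.2 = 0)

structure ZGood (n r : ℕ) (l : List (ℕ × ℕ)) : Prop where
  bd : ∀ p ∈ l, p.1 < n ∧ p.2 ≤ p.1
  pw : l.Pairwise DRel
  cnt : l.countP (fun p => p.2 == 0) = r

theorem filter_nil_of {t : ℕ} {l : List (ℕ × ℕ)} (h : ∀ q ∈ l, DRel (t, 0) q) :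
    (l.map Prod.snd).filter (fun x => x ≠ 0) = [] := by
  rw [List.filter_eq_nil_iff]
  intro x hx
  simp only [List.mem_map] at hx
  obtain ⟨q, hq, rfl⟩ := hx
  have := (h q hq).2.1
  simpa using this

theorem merge_split : ∀ {l : List (ℕ × ℕ)}, l.Pairwise DRel → mergeCols (splitCols l).1 (splitCols l).2 = l
  | [], _ => by simp [splitCols, mergeCols]
  | (t, b) :: l, h => by
    rw [List.pairwise_cons] at h
    have ih := merge_split h.2
    simp only [splitCols] at ih
    by_cases hb : b = 0
    · subst hb
      have e := filter_nil_of h.1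
      rw [e] at ih
      simp only [splitCols, List.map_cons]
      rw [List.filter_cons_of_neg (by simp), e]
      simp [mergeCols, ih]
    · simp only [splitCols, List.map_cons]
      rw [List.filter_cons_of_pos (by simpa using hb)]
      simp only [mergeCols]
      rw [ih]

theorem dom_split : ∀ {l : List (ℕ × ℕ)}, l.Pairwise DRel → (∀ p ∈ l, p.2 ≤ p.1) →
    Dom (splitCols l).1 (splitCols l).2
  | [], _, _ => by simp [splitCols, Dom]
  | (t, b) :: l, h, hb' => by
    rw [List.pairwise_cons] at h
    have ih := dom_split h.2 (fun p hp => hb' p (by simp [hp]))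
    simp only [splitCols] at ih
    by_cases hb : b = 0
    · subst hb
      have e := filter_nil_of h.1
      simp only [splitCols, List.map_cons]
      rw [List.filter_cons_of_neg (by simp), e]
      simp [Dom]
    · simp only [splitCols, List.map_cons]
      rw [List.filter_cons_of_pos (by simpa using hb)]
      exact ⟨hb' (t, b) (by simp), ih⟩

theorem len_split : ∀ (l : List (ℕ × ℕ)),
    (splitCols l).1.length = (splitCols l).2.length + l.countP (fun p => p.2 == 0)
  | [] => by simp [splitCols]
  | (t, b) :: l => by
    have ih := len_split l
    simp only [splitCols] at ih
    by_cases hb : b = 0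
    · subst hb
      simp only [splitCols, List.map_cons]
      rw [List.filter_cons_of_neg (by simp), List.countP_cons_of_pos (by simp), List.length_cons, ih]
      omega
    · simp only [splitCols, List.map_cons]
      rw [List.filter_cons_of_pos (by simpa using hb), List.countP_cons_of_neg (by simpa using hb), List.length_cons, ih,
        List.length_cons]
      omega

theorem split_good {n r : ℕ} {l : List (ℕ × ℕ)} (H : ZGood n r l) :
    XGood n 0 1 r (splitCols l).1 (splitCols l).2 := by
  refine ⟨?_, ?_, ?_, ?_, dom_split H.pw (fun p hp => (H.bd p hp).2), ?_⟩
  · exact List.pairwise_map.2 (H.pw.imp fun h => h.1)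
  · simp only [splitCols]
    rw [List.pairwise_filter, List.pairwise_map]
    refine H.pw.imp ?_
    intro a b h h1 h2
    have h3 := h.2.1
    have h4 := h.2.2
    simp at h1 h2
    show b.2 < a.2
    omega
  · intro t ht
    simp only [splitCols, List.mem_map] at ht
    obtain ⟨p, hp, rfl⟩ := ht
    exact ⟨Nat.zero_le _, (H.bd p hp).1⟩
  · intro t ht
    simp only [splitCols, List.mem_filter, List.mem_map] at ht
    obtain ⟨⟨p, hp, rfl⟩, h0⟩ := ht
    have := H.bd p hp
    simp at h0
    omega
  · rw [len_split, H.cnt]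

theorem split_merge : ∀ {T B : List ℕ}, Dom T B → (∀ b ∈ B, 1 ≤ b) → splitCols (mergeCols T B) = (T, B)
  | [], [], _, _ => by simp [splitCols, mergeCols]
  | [], _ :: _, h, _ => by simp [Dom] at h
  | t :: T, [], _, _ => by
    have ih := split_merge (T := T) (B := []) (by simp [Dom]) (by simp)
    simp only [splitCols, Prod.mk.injEq] at ih
    simp only [mergeCols, splitCols, List.map_cons]
    rw [List.filter_cons_of_neg (by simp), ih.1, ih.2]
  | t :: T, b :: B, h, hb => by
    simp only [Dom] at h
    have ih := split_merge h.2 (fun x hx => hb x (by simp [hx]))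
    simp only [splitCols, Prod.mk.injEq] at ih
    have := hb b (by simp)
    simp only [mergeCols, splitCols, List.map_cons]
    rw [List.filter_cons_of_pos (by simp; omega), ih.1, ih.2]

theorem mem_merge : ∀ {T B : List ℕ} {p : ℕ × ℕ}, Dom T B → p ∈ mergeCols T B →
    p.1 ∈ T ∧ (p.2 = 0 ∨ p.2 ∈ B) ∧ p.2 ≤ p.1
  | [], _, _, _, h => by simp [mergeCols] at h
  | t :: T, [], p, _, h => by
    simp only [mergeCols, List.mem_cons] at h
    rcases h with rfl | h
    · simp
    · have := mem_merge (T := T) (B := []) (by simp [Dom]) h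
      simp_all
  | t :: T, b :: B, p, hd, h => by
    simp only [mergeCols, List.mem_cons] at h
    simp only [Dom] at hd
    rcases h with rfl | h
    · simp [hd.1]
    · have := mem_merge hd.2 h
      simp only [List.mem_cons]
      tauto

theorem pw_merge : ∀ {T B : List ℕ}, Dom T B → T.Pairwise (· > ·) → B.Pairwise (· > ·) → (mergeCols T B).Pairwise DRel
  | [], _, _, _, _ => by simp [mergeCols]
  | t :: T, [], _, hT, _ => by
    rw [List.pairwise_cons] at hT
    simp only [mergeCols, List.pairwise_cons]
    refine ⟨fun q hq => ?_, pw_merge (by simp [Dom]) hT.2 (by simp)⟩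
    have := mem_merge (by simp [Dom]) hq
    have h1 := hT.1 _ this.1
    have h2 : q.2 = 0 := by simpa using this.2.1
    simp [DRel, h2, h1]
  | t :: T, b :: B, hd, hT, hB => by
    rw [List.pairwise_cons] at hT hB
    simp only [Dom] at hd
    simp only [mergeCols, List.pairwise_cons]
    refine ⟨fun q hq => ?_, pw_merge hd.2 hT.2 hB.2⟩
    have := mem_merge hd.2 hq
    have h1 := hT.1 _ this.1
    rcases this.2.1 with h2 | h2
    · simp [DRel, h2, h1]
    · have h3 := hB.1 _ h2
      refine ⟨h1, le_of_lt h3, fun h => ?_⟩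
      simp only at h
      omega

theorem merge_good {n r : ℕ} {T B : List ℕ} (H : XGood n 0 1 r T B) : ZGood n r (mergeCols T B) := by
  refine ⟨?_, pw_merge H.dom H.sT H.sB, ?_⟩
  · intro p hp
    have := mem_merge H.dom hp
    exact ⟨(H.bT _ this.1).2, this.2.2⟩
  · have h1 := len_split (mergeCols T B)
    rw [split_merge H.dom (fun b hb => (H.bB b hb).1)] at h1
    have := H.len
    simp only at h1
    omega

def ZS (n r : ℕ) : Set (List (ℕ × ℕ)) := {l | ZGood n r l}

theorem ZS_count (n r : ℕ) (hn : 1 ≤ n) : (ZS n r).encard = (PP (2 * n) (2 * r) : ℕ∞) := by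
  rw [← XS_omega n r hn]
  have : splitCols '' ZS n r = XS n 0 1 r := by
    ext ⟨T, B⟩
    constructor
    · rintro ⟨l, hl, h⟩
      have := split_good hl
      rw [h] at this
      exact this
    · intro H
      exact ⟨mergeCols T B, merge_good H, split_merge (XGood.dom H) (fun b hb => (XGood.bB H b hb).1)⟩
  rw [← this, Set.InjOn.encard_image]
  intro a ha b hb h
  rw [← merge_split (ZGood.pw ha), h, merge_split (ZGood.pw hb)]

theorem blobRank_eq {n : ℕ} {l : List (ℕ × ℕ)} (h : ∀ p ∈ l, p.1 < n ∧ p.2 ≤ p.1) :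
    blobRank l = l.countP (fun p => p.2 == 0) := by
  unfold blobRank
  apply List.countP_congr
  intro p hp
  have := h p hp
  simp
  omega

def IS (n r : ℕ) : Set (List (ℕ × ℕ)) := {l | IsIndexingMatrix n l ∧ blobRank l = r}

theorem ZGood_reverse {n r : ℕ} {l : List (ℕ × ℕ)} :
    ZGood n r l.reverse ↔ (l ∈ IS n r ∨ (l = [] ∧ r = 0)) := by
  constructor
  · rintro ⟨bd, pw, cnt⟩
    rw [List.countP_reverse] at cnt
    rw [List.pairwise_reverse] at pw
    simp only [List.mem_reverse] at bd
    by_cases hl : l = []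
    · subst hl
      right
      simp at cnt
      simp [cnt]
    · left
      refine ⟨⟨List.length_pos_iff.2 hl, ?_, bd, pw⟩, ?_⟩
      · have h1 : (l.map Prod.fst).Nodup := List.pairwise_map.2 (pw.imp fun h => h.1.ne)
        have h2 := List.toFinset_card_of_nodup h1
        have h3 : (l.map Prod.fst).toFinset ⊆ range n := by
          intro x hx
          simp only [List.mem_toFinset, List.mem_map] at hx
          obtain ⟨p, hp, rfl⟩ := hx
          simpa using (bd p hp).1
        have h4 := Finset.card_le_card h3
        rw [h2] at h4
        simpa using h4
      · rw [blobRank_eq bd, cnt]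
  · rintro (⟨⟨-, -, bd, pw⟩, h2⟩ | ⟨rfl, rfl⟩)
    · refine ⟨by simpa using bd, List.pairwise_reverse.2 pw, ?_⟩
      rw [List.countP_reverse, ← blobRank_eq bd, h2]
    · constructor <;> simp

theorem Omega_eq_s17 (n r : ℕ) (hn : 1 ≤ n) : Omega n r = PP (2 * n) (2 * r) := by
  have h1 : List.reverse '' ZS n r = IS n r ∪ (if r = 0 then {[]} else ∅) := by
    ext l
    have h2 : l ∈ List.reverse '' ZS n r ↔ ZGood n r l.reverse := by
      constructor
      · rintro ⟨l, h, rfl⟩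
        rw [List.reverse_reverse]
        exact h
      · intro h
        exact ⟨_, h, by simp⟩
    rw [h2, ZGood_reverse, Set.mem_union]
    by_cases hr : r = 0 <;> simp [hr]
  have h3 := ZS_count n r hn
  rw [← List.reverse_injective.encard_image, h1, Set.encard_union_eq] at h3
  · have hfin : (IS n r).Finite := by
      rw [← Set.encard_lt_top_iff]
      refine lt_of_le_of_lt le_self_add (h3 ▸ ENat.natCast_lt_top _)
    have h4 : Omega n r = (IS n r).ncard + (if r = 0 then 1 else 0) := rfl
    rw [h4]
    rw [← hfin.cast_ncard_eq] at h3
    by_cases hr : r = 0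
    · simp only [hr, if_true, Set.encard_singleton] at h3 ⊢
      exact_mod_cast h3
    · simp only [hr, if_false, Set.encard_empty] at h3 ⊢
      exact_mod_cast h3
  · rw [Set.disjoint_left]
    rintro l ⟨h, -⟩ h'
    split_ifs at h'
    · simp only [Set.mem_singleton_iff] at h'
      subst h'
      have := h.1
      simp at this
    · exact h'

/-- the cardinality of the abacus hook monoid `ℌ_{d,n}` is
`d^{n+1} ⬝ Σ_{k=0}^{n} Ω_k^{(n)} d^{-k} = d ⬝ Σ_{k=0}^{n} Ω_k^{(n)} d^{n-k}`. -/
theorem stmt17 (d n : ℕ) (hd : 1 ≤ d) (hn : 1 ≤ n) :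
    Nat.card (AbacusHookDiagram d n) =
      d * ∑ k ∈ Finset.range (n + 1), Omega n k * d ^ (n - k) := by
  rw [hook_card d n hd, Nd_eq d (2 * n) 0 n (by ring)]
  congr 1
  apply Finset.sum_congr rfl
  intro k _
  rw [Omega_eq_s17 n k hn, zero_add]
end
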